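/- There is no real polynomial P of degree 8 that defines the sign pattern (+,+,−,+,−,−,−,+,+), has no negative real roots, and has exactly four positive real roots, each simple. In other words, the sign pattern (+,+,−,+,−,−,−,+,+) is not realizable with the admissible pair (4,0). -/

import Mathlib

open Polynomial

/-- A degree-8 real polynomial `P` defines the sign pattern `σ = (σ_0, …, σ_8)`
(with entries `1` for `+`, `-1` for `−`) if for each `j` the coefficient of
`x^(8-j)` is nonzero and has sign `σ_j`. -/
def definesSignPattern (P : Polynomial ℝ) (σ : Fin 9 → ℝ) : Prop :=
  ∀ j : Fin 9, Real.sign (P.coeff (8 - (j : ℕ))) = σ j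

theorem pos_of_sign_eq_one {x : ℝ} (h : Real.sign x = 1) : 0 < x := by
  rcases lt_trichotomy x 0 with hx | rfl | hx
  · rw [Real.sign_of_neg hx] at h
    linarith
  · simp at h
  · exact hx

theorem neg_of_sign_eq_neg_one {x : ℝ} (h : Real.sign x = -1) : x < 0 := by
  have : 0 < -x := pos_of_sign_eq_one (by rw [Real.sign_neg, h, neg_neg])
  linarith

/-- An octic with the given signs of coefficients that is negative at points `u ∈ (0, 1)` and
`v > 1` cannot be nonnegative at both `1` and `-v`. The proof combines the four values with
nonnegative weights so that every coefficient contributes a nonnegative amount. -/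
theorem false_of_signs_of_values {a₀ a₁ a₂ a₃ a₄ a₅ a₆ a₇ a₈ u v : ℝ}
    (h₀ : 0 < a₀) (h₁ : 0 < a₁) (h₄ : a₄ < 0) (h₅ : 0 < a₅) (h₇ : 0 < a₇) (h₈ : 0 < a₈)
    (hu : 0 < u) (hu1 : u < 1) (hv : 1 < v) (f : ℝ → ℝ)
    (hf : ∀ x, f x = a₀ + a₁ * x + a₂ * x ^ 2 + a₃ * x ^ 3 + a₄ * x ^ 4 + a₅ * x ^ 5
      + a₆ * x ^ 6 + a₇ * x ^ 7 + a₈ * x ^ 8)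
    (hfu : f u < 0) (hf1 : 0 ≤ f 1) (hfv : f v < 0) (hfnv : 0 ≤ f (-v)) : False := by
  have hv0 : 0 < v := by linarith
  have hu2 : 0 < 1 - u ^ 2 := by nlinarith
  have hv2 : 0 < v ^ 2 - 1 := by nlinarith
  have huv2 : 0 < v ^ 2 - u ^ 2 := by linarith
  have hu1' : 0 < 1 - u := by linarith
  have hu3 : 0 < 1 - u ^ 3 := by nlinarith
  have hu4 : 0 < 1 - u ^ 4 := by nlinarith
  have hv4 : 0 < v ^ 4 - 1 := by nlinarith
  have huv4 : 0 < v ^ 4 - u ^ 4 := by linarith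
  set α := (v ^ 4 - 1) * v ^ 3 with hα
  set b := (1 - u ^ 4) * v * u ^ 2 with hb
  set d := u ^ 2 * (v ^ 4 * (1 - u) + u * (1 - u ^ 3)) with hd
  set γ := (v ^ 4 - u ^ 4) * u ^ 2 * v ^ 3 with hγ
  have hα0 : 0 < α := by positivity
  have hb0 : 0 < b := by positivity
  have hd0 : 0 < d := by positivity
  have hγ0 : 0 < γ := by positivity
  have hbd : 0 ≤ d - b := by
    have h4 : 0 ≤ v ^ 4 - 1 - 4 * (v - 1) := by
      have : v ^ 4 - 1 - 4 * (v - 1) = (v - 1) ^ 2 * (v ^ 2 + 2 * v + 3) := by ring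
      rw [this]
      positivity
    have h3 : 0 ≤ (v - 1) * (3 - u - u ^ 2 - u ^ 3) := mul_nonneg (by linarith) (by nlinarith)
    have : d - b = u ^ 2 * (1 - u) *
        ((v ^ 4 - 1 - 4 * (v - 1)) + (v - 1) * (3 - u - u ^ 2 - u ^ 3)) := by
      rw [hd, hb]
      ring
    rw [this]
    positivity
  have c₀ : 0 ≤ a₀ * (v * (1 - u ^ 2) * (v ^ 2 - 1) *
      ((v ^ 2 + 1) * v ^ 2 - (1 + u ^ 2) * u ^ 2)) := by
    have : 0 < (v ^ 2 + 1) * v ^ 2 - (1 + u ^ 2) * u ^ 2 := by nlinarith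
    positivity
  have c₁ : 0 ≤ a₁ * (u * v * (v ^ 2 - u ^ 2) * (v ^ 2 - 1) * (v ^ 2 * (1 - u) + (1 - u ^ 3))) := by
    positivity
  have c₄ : 0 ≤ -a₄ * (u ^ 2 * v ^ 3 * (1 - u ^ 2) * (v ^ 2 - 1) * (v ^ 2 - u ^ 2)) := by
    have : 0 < -a₄ := by linarith
    positivity
  have c₅ : 0 ≤ a₅ * (u ^ 2 * v ^ 3 * (v ^ 2 - u ^ 2) * (v ^ 2 - 1) * (1 - u) * (v ^ 2 - u)) := by
    have : 0 < v ^ 2 - u := by linarith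
    positivity
  have c₇ : 0 ≤ a₇ * (u ^ 2 * v ^ 3 * (v ^ 4 - u ^ 4) * (v ^ 4 - 1) * (1 - u)) := by
    positivity
  have c₈ : 0 ≤ a₈ * (u ^ 2 * v ^ 3 * (1 - u ^ 2) * (v ^ 2 - 1) *
      ((v ^ 4 - u ^ 4) + u ^ 2 * v ^ 2 * (v ^ 2 - u ^ 2))) := by
    positivity
  have key : α * f u + (d + b) / 2 * f v - γ * f 1 - (d - b) / 2 * f (-v) =
      a₀ * (v * (1 - u ^ 2) * (v ^ 2 - 1) * ((v ^ 2 + 1) * v ^ 2 - (1 + u ^ 2) * u ^ 2))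
      + a₁ * (u * v * (v ^ 2 - u ^ 2) * (v ^ 2 - 1) * (v ^ 2 * (1 - u) + (1 - u ^ 3)))
      + -a₄ * (u ^ 2 * v ^ 3 * (1 - u ^ 2) * (v ^ 2 - 1) * (v ^ 2 - u ^ 2))
      + a₅ * (u ^ 2 * v ^ 3 * (v ^ 2 - u ^ 2) * (v ^ 2 - 1) * (1 - u) * (v ^ 2 - u))
      + a₇ * (u ^ 2 * v ^ 3 * (v ^ 4 - u ^ 4) * (v ^ 4 - 1) * (1 - u))
      + a₈ * (u ^ 2 * v ^ 3 * (1 - u ^ 2) * (v ^ 2 - 1) *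
        ((v ^ 4 - u ^ 4) + u ^ 2 * v ^ 2 * (v ^ 2 - u ^ 2))) := by
    simp only [hf, hα, hb, hd, hγ]
    ring
  have e₁ : α * f u < 0 := mul_neg_of_pos_of_neg hα0 hfu
  have e₂ : (d + b) / 2 * f v < 0 := mul_neg_of_pos_of_neg (by positivity) hfv
  have e₃ : 0 ≤ γ * f 1 := by positivity
  have e₄ : 0 ≤ (d - b) / 2 * f (-v) := by positivity
  linarith

/-- A real polynomial without roots on a preconnected set that is positive at one point of the set
is positive on the whole set. -/
theorem eval_pos_of_isPreconnected (P : ℝ[X]) {s : Set ℝ} (hs : IsPreconnected s)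
    (hP : ∀ x ∈ s, P.eval x ≠ 0) {a x : ℝ} (ha : a ∈ s) (hx : x ∈ s) (h : 0 < P.eval a) :
    0 < P.eval x := by
  by_contra! hle
  obtain ⟨y, hy, hy0⟩ := hs.intermediate_value hx ha P.continuous.continuousOn ⟨hle, h.le⟩
  exact hP y hy hy0

/-- A polynomial factors through the product of linear factors at its simple roots, and the
cofactor does not vanish at these roots. -/
theorem exists_eq_prod_mul_of_simple_roots (P : ℝ[X]) {n : ℕ} {z : Fin n → ℝ}
    (hz : Function.Injective z) (hroot : ∀ i, P.eval (z i) = 0)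
    (hsimple : ∀ i, P.rootMultiplicity (z i) = 1) :
    ∃ Q : ℝ[X], P = (∏ i, (X - C (z i))) * Q ∧ ∀ i, Q.eval (z i) ≠ 0 := by
  have hdvd : ∏ i, (X - C (z i)) ∣ P :=
    Finset.prod_dvd_of_coprime (fun i _ j _ hij => pairwise_coprime_X_sub_C hz hij)
      fun i _ => dvd_iff_isRoot.2 (hroot i)
  obtain ⟨Q, rfl⟩ := hdvd
  refine ⟨Q, rfl, fun i hi => ?_⟩
  have h0 : (∏ i, (X - C (z i))) * Q ≠ 0 := by
    intro h
    simpa [h] using hsimple i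
  have : 2 ≤ ((∏ i, (X - C (z i))) * Q).rootMultiplicity (z i) := by
    rw [le_rootMultiplicity_iff h0, pow_two]
    exact mul_dvd_mul (Finset.dvd_prod_of_mem (fun i => X - C (z i)) (Finset.mem_univ i))
      (dvd_iff_isRoot.2 hi)
  rw [hsimple i] at this
  omega

/-- The given sign pattern is not realizable with the admissible pair (4,0):
there is no degree 8 real polynomial defining this pattern, with no negative
real roots and exactly four positive real roots, each simple. -/
theorem stmt1 :
    ¬ ∃ P : Polynomial ℝ, P.degree = 8 ∧
      definesSignPattern P ![1, 1, -1, 1, -1, -1, -1, 1, 1] ∧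
      (∀ x : ℝ, x < 0 → P.eval x ≠ 0) ∧
      ∃ z : Fin 4 → ℝ, StrictMono z ∧ (∀ i, 0 < z i) ∧
        (∀ i, P.eval (z i) = 0) ∧ (∀ i, P.rootMultiplicity (z i) = 1) ∧
        (∀ x : ℝ, 0 < x → P.eval x = 0 → ∃ i, x = z i) := by
  rintro ⟨P, hdeg, hsign, hneg, z, hmono, hzpos, hroot, hsimple, honly⟩
  have h₀ : 0 < P.coeff 0 := pos_of_sign_eq_one (by simpa using hsign 8)
  have h₁ : 0 < P.coeff 1 := pos_of_sign_eq_one (by simpa using hsign 7)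
  have h₄ : P.coeff 4 < 0 := neg_of_sign_eq_neg_one (by simpa using hsign 4)
  have h₅ : 0 < P.coeff 5 := pos_of_sign_eq_one (by simpa using hsign 3)
  have h₇ : 0 < P.coeff 7 := pos_of_sign_eq_one (by simpa using hsign 1)
  have h₈ : 0 < P.coeff 8 := pos_of_sign_eq_one (by simpa using hsign 0)
  have hP0 : 0 < P.eval 0 := by rwa [← coeff_zero_eq_eval_zero]
  have hPneg : ∀ x ≤ 0, 0 < P.eval x := fun x hx =>
    eval_pos_of_isPreconnected P isPreconnected_Iic
      (fun y (hy : y ≤ 0) => hy.lt_or_eq.elim (hneg y) fun h => by rw [h]; exact hP0.ne')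
      (Set.mem_Iic.2 le_rfl) hx hP0
  obtain ⟨Q, hPQ, hQz⟩ := exists_eq_prod_mul_of_simple_roots P hmono.injective hroot hsimple
  have hPeval : ∀ x, P.eval x =
      (x - z 0) * (x - z 1) * (x - z 2) * (x - z 3) * Q.eval x := fun x => by
    conv_lhs => rw [hPQ]
    simp [Fin.prod_univ_four]
  have p0 := hzpos 0
  have h01 : z 0 < z 1 := hmono (by decide)
  have h12 : z 1 < z 2 := hmono (by decide)
  have h23 : z 2 < z 3 := hmono (by decide)
  have p1 : 0 < z 1 := hzpos 1
  have hQ0 : 0 < Q.eval 0 := by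
    have h := hPeval 0
    have hz : 0 < z 0 * z 1 * z 2 * z 3 :=
      mul_pos (mul_pos (mul_pos p0 p1) (hzpos 2)) (hzpos 3)
    refine pos_of_mul_pos_right (a := z 0 * z 1 * z 2 * z 3) ?_ hz.le
    linarith
  have hQpos : ∀ x, 0 ≤ x → 0 < Q.eval x := fun x hx =>
    eval_pos_of_isPreconnected Q isPreconnected_Ici
      (fun y (hy : 0 ≤ y) hy0 => by
        rcases hy.eq_or_lt with rfl | hy'
        · exact hQ0.ne' hy0
        · obtain ⟨i, rfl⟩ := honly y hy' (by rw [hPeval, hy0, mul_zero])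
          exact hQz i hy0)
      (Set.mem_Ici.2 le_rfl) hx hQ0
  obtain ⟨u, hu0, hu1⟩ := exists_between h01
  obtain ⟨v, hv2, hv3⟩ := exists_between h23
  have hPu : P.eval u < 0 := by
    have : 0 < (u - z 0) * (z 1 - u) * (z 2 - u) * (z 3 - u) * Q.eval u :=
      mul_pos (mul_pos (mul_pos (mul_pos (by linarith) (by linarith)) (by linarith))
        (by linarith)) (hQpos u (by linarith))
    rw [hPeval]
    linarith
  have hPv : P.eval v < 0 := by
    have : 0 < (v - z 0) * (v - z 1) * (v - z 2) * (z 3 - v) * Q.eval v :=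
      mul_pos (mul_pos (mul_pos (mul_pos (by linarith) (by linarith)) (by linarith))
        (by linarith)) (hQpos v (by linarith))
    rw [hPeval]
    linarith
  have hnat : P.natDegree = 8 := natDegree_eq_of_degree_eq_some hdeg
  refine false_of_signs_of_values (a₂ := P.coeff 2 * z 1 ^ 2) (a₃ := P.coeff 3 * z 1 ^ 3)
    (a₆ := P.coeff 6 * z 1 ^ 6) h₀ (mul_pos h₁ p1) (mul_neg_of_neg_of_pos h₄ (pow_pos p1 4))
    (mul_pos h₅ (pow_pos p1 5)) (mul_pos h₇ (pow_pos p1 7)) (mul_pos h₈ (pow_pos p1 8))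
    (u := u / z 1) (v := v / z 1) (div_pos (by linarith) p1) ((div_lt_one p1).2 hu1)
    ((one_lt_div p1).2 (by linarith)) (fun x => P.eval (z 1 * x)) (fun x => ?_) ?_ ?_ ?_ ?_
  · simp only [eval_eq_sum_range, hnat, Finset.sum_range_succ, Finset.sum_range_zero]
    ring
  · simpa only [mul_div_cancel₀ _ p1.ne'] using hPu
  · simp only [mul_one, hroot, le_refl]
  · simpa only [mul_div_cancel₀ _ p1.ne'] using hPv
  · rw [mul_neg, mul_div_cancel₀ _ p1.ne']
    exact (hPneg _ (by linarith)).le
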